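/- (Property C) Let B be a nonunital σ-unital simple C*-algebra and let (e_n) be an approximate unit for B satisfying e_{n+1} e_n = e_n for all n ≥ 1 (with e_0 := 0 and r_n := e_n − e_{n−1}). For every Laurent polynomial h, every contractive X ∈ 𝓜(B), every ε > 0 and every K ≥ 1, there exists L ≥ 1 such that: for every sequence (α_j) in the closed unit ball of ℂ, if Y is the strict sum of Σ_{j=1}^∞ α_j r_j, then ‖e_K · h(Y X) · (1 − e_L)‖ < ε. -/

import Mathlib

open scoped MultiplierAlgebra

/-- `(e n)` is a (sequential) approximate unit for `B`: positive contractions with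
`‖e n * b - b‖ → 0` and `‖b * e n - b‖ → 0` for every `b ∈ B`. -/
def IsApproximateUnit {B : Type*} [NonUnitalCStarAlgebra B] [PartialOrder B]
    [StarOrderedRing B] (e : ℕ → B) : Prop :=
  (∀ n, 0 ≤ e n) ∧ (∀ n, ‖e n‖ ≤ 1) ∧
    (∀ b : B, Filter.Tendsto (fun n => ‖e n * b - b‖) Filter.atTop (nhds 0)) ∧
    (∀ b : B, Filter.Tendsto (fun n => ‖b * e n - b‖) Filter.atTop (nhds 0))

/-- The series `Σ_{j=1}^∞ b j` converges strictly to `Y` in the multiplier algebra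
`𝓜(ℂ, B)`. -/
def StrictlySumsTo {B : Type*} [NonUnitalCStarAlgebra B] (b : ℕ → B) (Y : 𝓜(ℂ, B)) : Prop :=
  ∀ x : B,
    Filter.Tendsto (fun N => (↑(∑ j ∈ Finset.Icc 1 N, b j) : 𝓜(ℂ, B)) * (x : 𝓜(ℂ, B)))
      Filter.atTop (nhds (Y * (x : 𝓜(ℂ, B)))) ∧
    Filter.Tendsto (fun N => (x : 𝓜(ℂ, B)) * (↑(∑ j ∈ Finset.Icc 1 N, b j) : 𝓜(ℂ, B)))
      Filter.atTop (nhds ((x : 𝓜(ℂ, B)) * Y))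

/-- Evaluation of the Laurent polynomial
`h(λ) = Σ_{n=0}^{N} β n λ^n + Σ_{m=1}^{M} γ m λ̄^m` at an element `x` of a unital
complex star algebra: `h(x) = Σ_{n=0}^{N} β n • x^n + Σ_{m=1}^{M} γ m • (x⋆)^m`. -/
def laurentEval {A : Type*} [Ring A] [StarRing A] [Module ℂ A]
    (N M : ℕ) (β γ : ℕ → ℂ) (x : A) : A :=
  (∑ n ∈ Finset.range (N + 1), β n • x ^ n) + ∑ m ∈ Finset.Icc 1 M, γ m • star x ^ m

section UniformTightness

variable {A ι : Type*} [NormedRing A]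

/-- A bounded family `f` is uniformly tight with respect to `e` if `‖e M * f i * (1 - e L)‖`
tends to zero as `L → ∞`, uniformly in `i`, for each fixed `M`. -/
structure UniformlyTight (e : ℕ → A) (f : ι → A) : Prop where
  bounded : ∃ C, ∀ i, ‖f i‖ ≤ C
  tight : ∀ M, ∀ ε > 0, ∀ᶠ L in Filter.atTop, ∀ i, ‖e M * f i * (1 - e L)‖ < ε

namespace UniformlyTight

variable {e : ℕ → A} {f g : ι → A}

lemma add (hf : UniformlyTight e f) (hg : UniformlyTight e g) :
    UniformlyTight e (fun i => f i + g i) where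
  bounded := by
    obtain ⟨C, hC⟩ := hf.bounded
    obtain ⟨D, hD⟩ := hg.bounded
    exact ⟨C + D, fun i => norm_add_le_of_le (hC i) (hD i)⟩
  tight M ε hε := by
    filter_upwards [hf.tight M _ (half_pos hε), hg.tight M _ (half_pos hε)] with L h₁ h₂ i
    rw [mul_add, add_mul]
    linarith [norm_add_le (e M * f i * (1 - e L)) (e M * g i * (1 - e L)), h₁ i, h₂ i]

lemma zero : UniformlyTight e (fun _ : ι => (0 : A)) where
  bounded := ⟨0, by simp⟩
  tight M ε hε := by simp [hε]

lemma sum {κ : Type*} (s : Finset κ) {F : κ → ι → A} (hF : ∀ k ∈ s, UniformlyTight e (F k)) :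
    UniformlyTight e (fun i => ∑ k ∈ s, F k i) := by
  classical
  induction s using Finset.induction with
  | empty => simpa using zero
  | insert k s hk ih =>
    simp only [Finset.sum_insert hk]
    exact (hF k (by simp)).add (ih fun j hj => hF j (by simp [hj]))

lemma smul {𝕜 : Type*} [NormedField 𝕜] [NormedAlgebra 𝕜 A] (c : 𝕜) (hf : UniformlyTight e f) :
    UniformlyTight e (fun i => c • f i) where
  bounded := by
    obtain ⟨C, hC⟩ := hf.bounded
    exact ⟨‖c‖ * C, fun i => (norm_smul_le _ _).trans (by gcongr; exact hC i)⟩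
  tight M ε hε := by
    filter_upwards [hf.tight M (ε / (‖c‖ + 1)) (by positivity)] with L h i
    rw [mul_smul_comm, smul_mul_assoc]
    have h' := (lt_div_iff₀ (by positivity)).1 (h i)
    have := norm_smul_le c (e M * f i * (1 - e L))
    nlinarith [norm_nonneg (e M * f i * (1 - e L))]

lemma mul (he : ∀ n, ‖e n‖ ≤ 1) (hf : UniformlyTight e f) (hg : UniformlyTight e g) :
    UniformlyTight e (fun i => f i * g i) where
  bounded := by
    obtain ⟨C, hC⟩ := hf.bounded
    obtain ⟨D, hD⟩ := hg.bounded
    exact ⟨C * D, fun i => norm_mul_le_of_le (hC i) (hD i)⟩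
  tight M ε hε := by
    obtain ⟨C, hC⟩ := hf.bounded
    obtain ⟨D, hD⟩ := hg.bounded
    set E := ‖(1 : A)‖ + 1
    have hE (L) : ‖1 - e L‖ ≤ E := norm_sub_le_of_le le_rfl (he L)
    have hE0 : 0 ≤ E := by positivity
    obtain ⟨P, hP⟩ := (hf.tight M (ε / 2 / (|D| * E + 1)) (by positivity)).exists
    filter_upwards [hg.tight P (ε / 2 / (|C| + 1)) (by positivity)] with L hL i
    have hsplit : e M * (f i * g i) * (1 - e L) =
        (e M * f i * (1 - e P)) * (g i * (1 - e L)) +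
          (e M * f i) * (e P * g i * (1 - e L)) := by noncomm_ring
    have h₁ : ‖(e M * f i * (1 - e P)) * (g i * (1 - e L))‖ < ε / 2 := by
      have hg' : ‖g i * (1 - e L)‖ ≤ |D| * E :=
        norm_mul_le_of_le ((hD i).trans (le_abs_self D)) (hE L)
      have h' := (lt_div_iff₀ (by positivity)).1 (hP i)
      refine (norm_mul_le_of_le le_rfl hg').trans_lt ?_
      nlinarith [norm_nonneg (e M * f i * (1 - e P))]
    have h₂ : ‖(e M * f i) * (e P * g i * (1 - e L))‖ < ε / 2 := by
      have hf' : ‖e M * f i‖ ≤ 1 * |C| :=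
        norm_mul_le_of_le (he M) ((hC i).trans (le_abs_self C))
      have h' := (lt_div_iff₀ (by positivity)).1 (hL i)
      refine (norm_mul_le_of_le hf' le_rfl).trans_lt ?_
      nlinarith [norm_nonneg (e P * g i * (1 - e L))]
    rw [hsplit]
    linarith [norm_add_le ((e M * f i * (1 - e P)) * (g i * (1 - e L)))
      ((e M * f i) * (e P * g i * (1 - e L)))]

lemma pow (he : ∀ n, ‖e n‖ ≤ 1) (hf : UniformlyTight e f)
    (h1 : UniformlyTight e (fun _ : ι => (1 : A))) (n : ℕ) : UniformlyTight e (fun i => f i ^ n) := by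
  induction n with
  | zero => simpa using h1
  | succ n ih => simpa only [pow_succ] using ih.mul he hf

protected lemma laurentEval [StarRing A] [NormedAlgebra ℂ A] (he : ∀ n, ‖e n‖ ≤ 1)
    (hf : UniformlyTight e f) (hfs : UniformlyTight e (fun i => star (f i)))
    (h1 : UniformlyTight e (fun _ : ι => (1 : A))) (N M : ℕ) (β γ : ℕ → ℂ) :
    UniformlyTight e (fun i => laurentEval N M β γ (f i)) :=
  add (sum _ fun n _ => (hf.pow he h1 n).smul (β n))
    (sum _ fun m _ => (hfs.pow he h1 m).smul (γ m))

end UniformlyTight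

end UniformTightness

namespace DoubleCentralizer

variable {B : Type*} [NonUnitalCStarAlgebra B]

lemma coe_mul_eq (a b : B) : ((a * b : B) : 𝓜(ℂ, B)) = a * b := map_mul (coeHom (𝕜 := ℂ)) a b

lemma coe_sub_eq (a b : B) : ((a - b : B) : 𝓜(ℂ, B)) = a - b := map_sub (coeHom (𝕜 := ℂ)) a b

lemma coe_star_eq (a : B) : ((star a : B) : 𝓜(ℂ, B)) = star (a : 𝓜(ℂ, B)) :=
  map_star (coeHom (𝕜 := ℂ)) a

lemma norm_coe (b : B) : ‖(b : 𝓜(ℂ, B))‖ = ‖b‖ := by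
  rw [← norm_fst, coe_fst, ContinuousLinearMap.opNorm_mul_apply]

lemma mul_coe (T : 𝓜(ℂ, B)) (b : B) : T * (b : 𝓜(ℂ, B)) = (T.fst b : B) := by
  refine ext _ _ _ _ (Prod.ext ?_ ?_)
  · ext x
    have h (y : B) : y * T.fst (b * x) = y * (T.fst b * x) := by
      rw [← T.central, ← mul_assoc, T.central, mul_assoc]
    have := h (star (T.fst (b * x) - T.fst b * x))
    rw [← sub_eq_zero, ← mul_sub, CStarRing.star_mul_self_eq_zero_iff, sub_eq_zero] at this
    simpa using this
  · ext x
    simpa using T.central x b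

lemma coe_mul (T : 𝓜(ℂ, B)) (b : B) : (b : 𝓜(ℂ, B)) * T = (T.snd b : B) := by
  have h := congrArg star (mul_coe (star T) (star b))
  rw [coe_star_eq, ← star_mul, star_star, ← coe_star_eq, star_fst, star_star, star_star] at h
  exact h

/-- A norm bound for a multiplier can be checked on the embedded algebra. -/
lemma norm_le_of_mul_coe {T : 𝓜(ℂ, B)} {C : ℝ} (hC : 0 ≤ C)
    (h : ∀ b : B, ‖T * (b : 𝓜(ℂ, B))‖ ≤ C * ‖b‖) : ‖T‖ ≤ C := by
  rw [← norm_fst]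
  refine ContinuousLinearMap.opNorm_le_bound _ hC fun b => ?_
  rw [← norm_coe, ← mul_coe]
  exact h b

end DoubleCentralizer

open DoubleCentralizer

section Multipliers

variable {B : Type*} [NonUnitalCStarAlgebra B]

lemma StrictlySumsTo.star {b : ℕ → B} {Y : 𝓜(ℂ, B)} (h : StrictlySumsTo b Y) :
    StrictlySumsTo (fun j => star (b j)) (star Y) := by
  intro x
  have key (N : ℕ) : (↑(∑ j ∈ Finset.Icc 1 N, Star.star (b j)) : 𝓜(ℂ, B)) =
      Star.star (↑(∑ j ∈ Finset.Icc 1 N, b j) : 𝓜(ℂ, B)) := by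
    rw [← star_sum, coe_star_eq]
  simp only [key]
  constructor
  · simpa [coe_star_eq] using (h (Star.star x)).2.star
  · simpa [coe_star_eq] using (h (Star.star x)).1.star

lemma StrictlySumsTo.norm_le {b : ℕ → B} {Y : 𝓜(ℂ, B)} (h : StrictlySumsTo b Y) {C : ℝ}
    (hC : ∀ N, ‖∑ j ∈ Finset.Icc 1 N, b j‖ ≤ C) : ‖Y‖ ≤ C := by
  refine norm_le_of_mul_coe ((norm_nonneg _).trans (hC 0)) fun x => ?_
  refine le_of_tendsto (h x).1.norm (Filter.Eventually.of_forall fun N => ?_)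
  exact norm_mul_le_of_le ((norm_coe _).trans_le (hC N)) (norm_coe _).le

variable {e : ℕ → B}

lemma mul_eq_right_of_lt (he0 : e 0 = 0)
    (hee : ∀ n ≥ 1, e (n + 1) * e n = e n) {m n : ℕ} (h : n < m) : e m * e n = e n := by
  rcases Nat.eq_zero_or_pos n with rfl | hn
  · simp [he0]
  induction m, h using Nat.le_induction with
  | base => exact hee n hn
  | succ m hm ih =>
    have hm' : n < m := hm
    calc e (m + 1) * e n = e (m + 1) * (e m * e n) := by rw [ih]
      _ = e n := by rw [← mul_assoc, hee m (by omega), ih]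

lemma mul_eq_left_of_lt (he0 : e 0 = 0) (hsa : ∀ n, IsSelfAdjoint (e n))
    (hee : ∀ n ≥ 1, e (n + 1) * e n = e n) {m n : ℕ} (h : n < m) : e n * e m = e n := by
  simpa [(hsa _).star_eq] using congrArg star (mul_eq_right_of_lt he0 hee h)

lemma difference_mul_difference_eq_zero (he0 : e 0 = 0) (hsa : ∀ n, IsSelfAdjoint (e n))
    (hee : ∀ n ≥ 1, e (n + 1) * e n = e n) {i j : ℕ} (h : i + 2 ≤ j) :
    (e i - e (i - 1)) * (e j - e (j - 1)) = 0 := by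
  have h' {m n : ℕ} := mul_eq_left_of_lt he0 hsa hee (m := m) (n := n)
  rw [sub_mul, mul_sub, mul_sub, h' (by omega), h' (by omega), h' (by omega), h' (by omega)]
  simp

/-- A real linear combination of the differences whose indices have a fixed parity. -/
lemma norm_sum_real_smul_difference_parity_le (he0 : e 0 = 0) (hsa : ∀ n, IsSelfAdjoint (e n))
    (he1 : ∀ n, ‖e n‖ ≤ 1) (hee : ∀ n ≥ 1, e (n + 1) * e n = e n)
    {t : ℕ → ℝ} (ht : ∀ j, |t j| ≤ 1) (s : Finset ℕ) (q : ℕ) :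
    ‖∑ j ∈ s, if j % 2 = q then (t j : ℂ) • (e j - e (j - 1)) else 0‖ ≤ 2 := by
  have h0 {i j : ℕ} := difference_mul_difference_eq_zero he0 hsa hee (i := i) (j := j)
  have hrsa (j : ℕ) : IsSelfAdjoint (e j - e (j - 1)) := (hsa j).sub (hsa _)
  have horth : ∀ i j : ℕ, i ≠ j → i % 2 = q → j % 2 = q →
      (e i - e (i - 1)) * (e j - e (j - 1)) = 0 := by
    intro i j hij hi hj
    rcases lt_or_gt_of_ne hij with h | h
    · exact h0 (by omega)
    · simpa only [star_mul, (hrsa _).star_eq, star_zero] using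
        congrArg star (h0 (i := j) (j := i) (by omega))
  have hsum := IsSelfAdjoint.nnnorm_sum_eq_sup (A := B)
    (f := fun j => if j % 2 = q then (t j : ℂ) • (e j - e (j - 1)) else 0) s
    (fun j _ => by
      split_ifs
      · exact IsSelfAdjoint.smul (Complex.conj_ofReal _) (hrsa j)
      · exact IsSelfAdjoint.zero B)
    (fun i j hij => by
      dsimp only [Function.onFun]
      split_ifs with hi hj <;> simp [smul_mul_smul_comm]
      simp [horth i j hij hi hj])
  have hle : ‖∑ j ∈ s, if j % 2 = q then (t j : ℂ) • (e j - e (j - 1)) else 0‖₊ ≤ 2 := by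
    rw [hsum, Finset.sup_le_iff]
    intro j _
    rw [← NNReal.coe_le_coe, coe_nnnorm]
    split_ifs
    · rw [norm_smul, Complex.norm_real, Real.norm_eq_abs]
      have := norm_sub_le_of_le (he1 j) (he1 (j - 1))
      push_cast
      nlinarith [ht j, norm_nonneg (e j - e (j - 1)), abs_nonneg (t j)]
    · simp
  exact_mod_cast hle

lemma norm_sum_real_smul_difference_le (he0 : e 0 = 0) (hsa : ∀ n, IsSelfAdjoint (e n))
    (he1 : ∀ n, ‖e n‖ ≤ 1) (hee : ∀ n ≥ 1, e (n + 1) * e n = e n)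
    {t : ℕ → ℝ} (ht : ∀ j, |t j| ≤ 1) (s : Finset ℕ) :
    ‖∑ j ∈ s, (t j : ℂ) • (e j - e (j - 1))‖ ≤ 4 := by
  have h := norm_sum_real_smul_difference_parity_le he0 hsa he1 hee ht s
  have hsplit : ∑ j ∈ s, (t j : ℂ) • (e j - e (j - 1)) =
      (∑ j ∈ s, if j % 2 = 0 then (t j : ℂ) • (e j - e (j - 1)) else 0) +
        ∑ j ∈ s, if j % 2 = 1 then (t j : ℂ) • (e j - e (j - 1)) else 0 := by
    rw [← Finset.sum_add_distrib]
    refine Finset.sum_congr rfl fun j _ => ?_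
    rcases Nat.mod_two_eq_zero_or_one j with hj | hj <;> simp [hj]
  rw [hsplit]
  linarith [norm_add_le_of_le (h 0) (h 1)]

lemma norm_sum_smul_difference_le (he0 : e 0 = 0) (hsa : ∀ n, IsSelfAdjoint (e n))
    (he1 : ∀ n, ‖e n‖ ≤ 1) (hee : ∀ n ≥ 1, e (n + 1) * e n = e n)
    {α : ℕ → ℂ} (hα : ∀ j, ‖α j‖ ≤ 1) (s : Finset ℕ) :
    ‖∑ j ∈ s, α j • (e j - e (j - 1))‖ ≤ 8 := by
  have h {t : ℕ → ℝ} (ht : ∀ j, |t j| ≤ 1) :=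
    norm_sum_real_smul_difference_le he0 hsa he1 hee ht s
  have hre := h fun j => (Complex.abs_re_le_norm (α j)).trans (hα j)
  have him := h fun j => (Complex.abs_im_le_norm (α j)).trans (hα j)
  have hsplit : ∑ j ∈ s, α j • (e j - e (j - 1)) =
      (∑ j ∈ s, ((α j).re : ℂ) • (e j - e (j - 1))) +
        Complex.I • ∑ j ∈ s, ((α j).im : ℂ) • (e j - e (j - 1)) := by
    rw [Finset.smul_sum, ← Finset.sum_add_distrib]
    refine Finset.sum_congr rfl fun j _ => ?_
    rw [smul_smul, ← add_smul, mul_comm, Complex.re_add_im]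
  rw [hsplit]
  refine (norm_add_le _ _).trans ?_
  rw [norm_smul, Complex.norm_I, one_mul]
  linarith

/-- Strict sums of the differences of `e` are banded with respect to `e`. -/
lemma StrictlySumsTo.mul_mul_one_sub_eq_zero (he0 : e 0 = 0) (hsa : ∀ n, IsSelfAdjoint (e n))
    (hee : ∀ n ≥ 1, e (n + 1) * e n = e n) {α : ℕ → ℂ} {Y : 𝓜(ℂ, B)}
    (hY : StrictlySumsTo (fun j => α j • (e j - e (j - 1))) Y) {M L : ℕ} (hL : M + 2 ≤ L) :
    (e M : 𝓜(ℂ, B)) * Y * (1 - (e L : 𝓜(ℂ, B))) = 0 := by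
  have h' {m n : ℕ} := mul_eq_left_of_lt he0 hsa hee (m := m) (n := n)
  have hterm (j : ℕ) :
      e M * (α j • (e j - e (j - 1))) = e M * (α j • (e j - e (j - 1))) * e L := by
    rcases le_or_gt (M + 2) j with hj | hj
    · rw [mul_smul_comm, mul_sub, h' (by omega), h' (by omega)]
      simp
    · rw [mul_assoc, smul_mul_assoc, sub_mul, h' (by omega), h' (by omega)]
  refine tendsto_nhds_unique ((hY (e M)).2.mul_const _) (tendsto_const_nhds.congr fun N => ?_)
  rw [mul_one_sub, eq_comm, sub_eq_zero, ← coe_mul_eq, ← coe_mul_eq]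
  congr 1
  rw [Finset.mul_sum, Finset.sum_mul]
  exact Finset.sum_congr rfl fun j _ => hterm j

/-- Families of strict sums of the differences of `e` with coefficients in the closed unit disc
are uniformly tight. -/
lemma uniformlyTight_of_strictlySumsTo (he0 : e 0 = 0) (hsa : ∀ n, IsSelfAdjoint (e n))
    (he1 : ∀ n, ‖e n‖ ≤ 1) (hee : ∀ n ≥ 1, e (n + 1) * e n = e n) {ι : Type*}
    {Y : ι → 𝓜(ℂ, B)} (hY : ∀ i, ∃ α : ℕ → ℂ, (∀ j, ‖α j‖ ≤ 1) ∧
      StrictlySumsTo (fun j => α j • (e j - e (j - 1))) (Y i)) :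
    UniformlyTight (fun n => (e n : 𝓜(ℂ, B))) Y where
  bounded := by
    refine ⟨8, fun i => ?_⟩
    obtain ⟨α, hα, h⟩ := hY i
    exact h.norm_le fun N => norm_sum_smul_difference_le he0 hsa he1 hee hα _
  tight M ε hε := by
    filter_upwards [Filter.eventually_ge_atTop (M + 2)] with L hL i
    obtain ⟨α, -, h⟩ := hY i
    rw [h.mul_mul_one_sub_eq_zero he0 hsa hee hL]
    simpa using hε

/-- A single multiplier is tight with respect to an approximate unit. -/
lemma uniformlyTight_const
    (he : ∀ b : B, Filter.Tendsto (fun n => ‖b * e n - b‖) Filter.atTop (nhds 0)) {ι : Type*}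
    (X : 𝓜(ℂ, B)) :
    UniformlyTight (fun n => (e n : 𝓜(ℂ, B))) (fun _ : ι => X) where
  bounded := ⟨‖X‖, fun _ => le_rfl⟩
  tight M ε hε := by
    filter_upwards [(he (X.snd (e M))).eventually_lt_const hε] with L hL _
    rwa [coe_mul, mul_one_sub, ← coe_mul_eq, ← coe_sub_eq, norm_coe, norm_sub_rev]

end Multipliers

/-- Property C: for every Laurent polynomial `h`, every contractive
`X ∈ 𝓜(B)`, every `ε > 0` and every `K ≥ 1`, there is `L ≥ 1` such that for every
coefficient sequence `(α j)` in the closed unit ball of `ℂ`, the strict sum `Y` of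
`Σ α j • r j` satisfies `‖e K * h(Y * X) * (1 - e L)‖ < ε`. -/
theorem statement_8 {B : Type*} [NonUnitalCStarAlgebra B] [PartialOrder B] [StarOrderedRing B]
    (hnonunital : ¬∃ u : B, ∀ b : B, u * b = b ∧ b * u = b)
    (hsimple : ∀ I : TwoSidedIdeal B, IsClosed (I : Set B) → I = ⊥ ∨ I = ⊤)
    (e : ℕ → B) (he : IsApproximateUnit e) (he0 : e 0 = 0)
    (hee : ∀ n ≥ 1, e (n + 1) * e n = e n)
    (Nh Mh : ℕ) (β γ : ℕ → ℂ)
    (X : 𝓜(ℂ, B)) (hX : ‖X‖ ≤ 1)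
    (ε : ℝ) (hε : 0 < ε) (K : ℕ) (hK : 1 ≤ K) :
    ∃ L ≥ 1, ∀ α : ℕ → ℂ, (∀ j, ‖α j‖ ≤ 1) →
      ∀ Y : 𝓜(ℂ, B),
        StrictlySumsTo (fun j => α j • (e j - e (j - 1))) Y →
        ‖(e K : 𝓜(ℂ, B)) * laurentEval Nh Mh β γ (Y * X) * (1 - (e L : 𝓜(ℂ, B)))‖ < ε := by
  obtain ⟨hpos, he1, -, hr⟩ := he
  have hsa (n : ℕ) : IsSelfAdjoint (e n) := IsSelfAdjoint.of_nonneg (hpos n)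
  have he1' (n : ℕ) : ‖(e n : 𝓜(ℂ, B))‖ ≤ 1 := (norm_coe _).trans_le (he1 n)
  let S : Set 𝓜(ℂ, B) := {Y | ∃ α : ℕ → ℂ, (∀ j, ‖α j‖ ≤ 1) ∧
    StrictlySumsTo (fun j => α j • (e j - e (j - 1))) Y}
  have hY : UniformlyTight (fun n => (e n : 𝓜(ℂ, B))) (fun Y : S => (Y : 𝓜(ℂ, B))) :=
    uniformlyTight_of_strictlySumsTo he0 hsa he1 hee fun Y => Y.2
  have hYs : UniformlyTight (fun n => (e n : 𝓜(ℂ, B))) (fun Y : S => star (Y : 𝓜(ℂ, B))) := by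
    refine uniformlyTight_of_strictlySumsTo he0 hsa he1 hee fun Y => ?_
    obtain ⟨α, hα, h⟩ := Y.2
    refine ⟨fun j => star (α j), fun j => (norm_star _).trans_le (hα j), ?_⟩
    simpa only [star_smul, star_sub, (hsa _).star_eq] using h.star
  have hconst (T : 𝓜(ℂ, B)) := uniformlyTight_const hr (ι := S) T
  have hZ := hY.mul he1' (hconst X)
  have hZs := (hconst (star X)).mul he1' hYs
  simp only [← star_mul] at hZs
  have hmain := hZ.laurentEval he1' hZs (hconst 1) Nh Mh β γ
  obtain ⟨L, hL, hL1⟩ :=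
    ((hmain.tight K ε hε).and (Filter.eventually_ge_atTop 1)).exists
  exact ⟨L, hL1, fun α hα Y h => hL ⟨Y, α, hα, h⟩⟩
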